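/- (Corollary 3.2) Let 1 < α < 2, μ < 0, C > 0, M > 0, and let S_α : [0,∞) → B(X) be a strongly continuous family of bounded linear operators on a Banach space X with S_α(0) = I and ‖S_α(t)‖ ≤ CM/(1 + |μ|t^α) for all t ≥ 0. Let r > 0, ω > 0, φ ∈ C = C([−r,0],X), and let g, f : [0,∞) × C → X satisfy: g, f ∈ PSAP_{ω,r}(C,X); g(·,0), f(·,0) ∈ C_b([0,∞),X); and there exist positive constants L_g, L_f with ‖g(t,ψ)−g(t,φ)‖ ≤ L_g‖ψ−φ‖_C and ‖f(t,ψ)−f(t,φ)‖ ≤ L_f‖ψ−φ‖_C for all t ≥ 0 and ψ, φ ∈ C. If L_g + CM L_f |μ|^{−1/α}π/(α sin(π/α)) < 1, then there exists a unique function u ∈ C_b([−r,∞),X) with u_0 = φ, u(t) = S_α(t)[φ(0) − g(0,φ)] + g(t,u_t) + ∫_0^t S_α(t−s) f(s,u_s) ds for all t ≥ 0, and the restriction of u to [0,∞) belongs to PSAP_{ω,r}(X). -/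

import Mathlib

open MeasureTheory Filter Set

/-- `v ∈ PSAP_{ω,r}(Y)`: pseudo S-asymptotically ω-periodic of class r. -/
def PSAPclass {Y : Type*} [NormedAddCommGroup Y] (ω r : ℝ) (v : ℝ → Y) : Prop :=
  Tendsto (fun T : ℝ => (1 / T) * ∫ s in r..T, ⨆ τ ∈ Set.Icc (s - r) s, ‖v (τ + ω) - v τ‖)
    atTop (nhds 0)

/-- `F ∈ PSAP_{ω,r}(E,Y)`: uniformly pseudo S-asymptotically ω-periodic of class r. -/
def PSAPunif {E Y : Type*} [NormedAddCommGroup E] [NormedAddCommGroup Y] (ω r : ℝ)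
    (F : ℝ → E → Y) : Prop :=
  ∀ L > 0, Tendsto (fun T : ℝ => (1 / T) * ∫ s in r..T,
      ⨆ τ ∈ Set.Icc (s - r) s, ⨆ x ∈ {x : E | ‖x‖ ≤ L}, ‖F (τ + ω) x - F τ x‖)
    atTop (nhds 0)

/-- The history `u_t ∈ C([−r,0],X)`, `u_t(θ) = u(t+θ)`. -/
noncomputable def hist {X : Type*} [NormedAddCommGroup X] (r : ℝ) (u : ℝ → X) (t : ℝ) :
    C(Set.Icc (-r) (0:ℝ), X) := by
  classical
  exact if h : Continuous (fun θ : Set.Icc (-r) (0:ℝ) => u (t + ↑θ)) then ⟨_, h⟩ else 0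

/-- `u` is a mild solution of system (1.2) with initial history `φ`:
`u ∈ C_b([−r,∞),X)`, `u_0 = φ`, and
`u(t) = S_α(t)[φ(0) − g(0,φ)] + g(t,u_t) + ∫_0^t S_α(t−s) f(s,u_s) ds` for `t ≥ 0`. -/
def IsMildSolution {X : Type*} [NormedAddCommGroup X] [NormedSpace ℝ X]
    (r : ℝ) (h0 : (0:ℝ) ∈ Set.Icc (-r) (0:ℝ))
    (S : ℝ → X →L[ℝ] X) (φ : C(Set.Icc (-r) (0:ℝ), X))
    (g f : ℝ → C(Set.Icc (-r) (0:ℝ), X) → X) (u : ℝ → X) : Prop :=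
  ContinuousOn u (Set.Ici (-r)) ∧ (∃ B, ∀ t ≥ -r, ‖u t‖ ≤ B) ∧
  (∀ θ : Set.Icc (-r) (0:ℝ), u ↑θ = φ θ) ∧
  ∀ t ≥ (0:ℝ), u t = S t (φ ⟨0, h0⟩ - g 0 φ) + g t (hist r u t) +
    ∫ s in (0:ℝ)..t, S (t - s) (f s (hist r u s))

open scoped ENNReal NNReal Topology

/-- The supremum of `h` over the window `[s - r, s]`. -/
noncomputable def windowSup (r : ℝ) (h : ℝ → ℝ≥0∞) (s : ℝ) : ℝ≥0∞ :=
  ⨆ τ ∈ Set.Icc (s - r) s, h τ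

/-- The averages of `h` over `[0, T]` tend to zero as `T → ∞`. -/
def MeanZero (h : ℝ → ℝ≥0∞) : Prop :=
  Tendsto (fun T : ℝ => (∫⁻ s in Set.Icc 0 T, h s) / ENNReal.ofReal T) atTop (𝓝 0)

lemma windowSup_eq (r : ℝ) (h : ℝ → ℝ≥0∞) (s : ℝ) :
    windowSup r h s = ⨆ c ∈ Set.Icc 0 r, h (s - c) := by
  apply le_antisymm
  · refine iSup₂_le fun τ hτ => ?_
    refine le_iSup₂_of_le (s - τ) ⟨by linarith [hτ.2], by linarith [hτ.1]⟩ ?_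
    simp
  · refine iSup₂_le fun c hc => ?_
    exact le_iSup₂_of_le (s - c) ⟨by linarith [hc.2], by linarith [hc.1]⟩ le_rfl

lemma le_windowSup {r : ℝ} (h : ℝ → ℝ≥0∞) {s τ : ℝ} (h₁ : s - r ≤ τ) (h₂ : τ ≤ s) :
    h τ ≤ windowSup r h s :=
  le_iSup₂_of_le τ ⟨h₁, h₂⟩ le_rfl

lemma windowSup_le {r : ℝ} {h : ℝ → ℝ≥0∞} {s : ℝ} {b : ℝ≥0∞}
    (hb : ∀ τ, s - r ≤ τ → τ ≤ s → h τ ≤ b) : windowSup r h s ≤ b :=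
  iSup₂_le fun τ hτ => hb τ hτ.1 hτ.2

lemma LowerSemicontinuous.windowSup (r : ℝ) {h : ℝ → ℝ≥0∞} (hh : LowerSemicontinuous h) :
    LowerSemicontinuous (windowSup r h) := by
  have : _root_.windowSup r h = fun s => ⨆ c ∈ Set.Icc 0 r, h (s - c) :=
    funext (windowSup_eq r h)
  rw [this]
  exact lowerSemicontinuous_biSup fun c _ => hh.comp (continuous_id.sub continuous_const)

lemma windowSup_windowSup_le (r : ℝ) (h : ℝ → ℝ≥0∞) (s : ℝ) :
    windowSup r (windowSup r h) s ≤ windowSup r h s + windowSup r h (s - r) := by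
  refine windowSup_le fun τ h₁ h₂ => windowSup_le fun τ' h₃ h₄ => ?_
  rcases le_total (s - r) τ' with hc | hc
  · exact (le_windowSup h hc (by linarith)).trans le_self_add
  · exact (le_windowSup h (by linarith) hc).trans le_add_self

lemma MeanZero.add {h₁ h₂ : ℝ → ℝ≥0∞} (m₁ : MeanZero h₁) (m₂ : MeanZero h₂)
    (hm : Measurable h₁) : MeanZero (fun s => h₁ s + h₂ s) := by
  have := Tendsto.add m₁ m₂
  rw [add_zero] at this
  refine this.congr fun T => ?_
  rw [lintegral_add_left hm, ENNReal.add_div]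

lemma MeanZero.const_mul {h : ℝ → ℝ≥0∞} (m : MeanZero h) {c : ℝ≥0∞} (hc : c ≠ ∞) :
    MeanZero (fun s => c * h s) := by
  have := ENNReal.Tendsto.const_mul (a := c) m (Or.inr hc)
  rw [mul_zero] at this
  refine this.congr fun T => ?_
  rw [lintegral_const_mul' _ _ hc, mul_div_assoc]

lemma tendsto_const_div_ofReal {c : ℝ≥0∞} (hc : c ≠ ∞) :
    Tendsto (fun T : ℝ => c / ENNReal.ofReal T) atTop (𝓝 0) := by
  have := ENNReal.Tendsto.const_div (a := c) ENNReal.tendsto_ofReal_atTop (Or.inr hc)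
  simpa using this

/-- A bounded function which up to arbitrarily small errors is eventually dominated by functions
with vanishing mean has vanishing mean. -/
lemma MeanZero.of_forall_eventually_le {h : ℝ → ℝ≥0∞} {B : ℝ≥0∞} (hB : B ≠ ∞)
    (hle : ∀ s, h s ≤ B)
    (happ : ∀ ε : ℝ≥0∞, 0 < ε → ∃ h', MeanZero h' ∧ ∀ᶠ s in atTop, h s ≤ h' s + ε) :
    MeanZero h := by
  refine ENNReal.tendsto_nhds_zero.2 fun ε hε => ?_
  have hε2 : 0 < ε / 3 := ENNReal.div_pos hε.ne' (by norm_num)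
  obtain ⟨h', m', hev⟩ := happ (ε / 3) hε2
  obtain ⟨T₀, hT₀⟩ := eventually_atTop.1 hev
  have hfin : B * volume (Set.Icc 0 T₀) ≠ ∞ := ENNReal.mul_ne_top hB (by simp)
  filter_upwards [ENNReal.tendsto_nhds_zero.1 m' _ hε2,
    ENNReal.tendsto_nhds_zero.1 (tendsto_const_div_ofReal hfin) _ hε2,
    eventually_gt_atTop 0] with T h₁ h₂ hT
  have hT' : ENNReal.ofReal T ≠ 0 := by simpa using hT
  have key : ∫⁻ s in Set.Icc 0 T, h s ≤
      B * volume (Set.Icc 0 T₀) + (ε / 3 * ENNReal.ofReal T + ∫⁻ s in Set.Icc 0 T, h' s) := by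
    calc ∫⁻ s in Set.Icc 0 T, h s
        ≤ ∫⁻ s in Set.Icc 0 T, ((Set.Icc 0 T₀).indicator (fun _ => B) s + (ε / 3 + h' s)) := by
          refine setLIntegral_mono_ae' measurableSet_Icc (ae_of_all _ fun s hs => ?_)
          by_cases hc : s ≤ T₀
          · rw [Set.indicator_of_mem (show s ∈ Set.Icc 0 T₀ from ⟨hs.1, hc⟩)]
            exact (hle s).trans le_self_add
          · rw [add_comm (ε / 3)]
            exact (hT₀ s (not_le.1 hc).le).trans le_add_self
      _ = (∫⁻ s in Set.Icc 0 T, (Set.Icc 0 T₀).indicator (fun _ => B) s) +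
            (ε / 3 * ENNReal.ofReal T + ∫⁻ s in Set.Icc 0 T, h' s) := by
          rw [lintegral_add_left (measurable_const.indicator measurableSet_Icc),
            lintegral_add_left measurable_const, setLIntegral_const, Real.volume_Icc, sub_zero]
      _ ≤ _ := by
          refine add_le_add_left ?_ _
          refine (lintegral_mono' Measure.restrict_le_self le_rfl).trans ?_
          rw [lintegral_indicator_const measurableSet_Icc]
  calc (∫⁻ s in Set.Icc 0 T, h s) / ENNReal.ofReal T
      ≤ (B * volume (Set.Icc 0 T₀) + (ε / 3 * ENNReal.ofReal T + ∫⁻ s in Set.Icc 0 T, h' s)) /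
          ENNReal.ofReal T := by gcongr
    _ = B * volume (Set.Icc 0 T₀) / ENNReal.ofReal T +
          (ε / 3 + (∫⁻ s in Set.Icc 0 T, h' s) / ENNReal.ofReal T) := by
        rw [ENNReal.add_div, ENNReal.add_div, ENNReal.mul_div_cancel_right hT' (by simp)]
    _ ≤ ε / 3 + (ε / 3 + ε / 3) := by gcongr
    _ = ε := by rw [← add_assoc, ENNReal.add_thirds]

lemma MeanZero.mono {h h' : ℝ → ℝ≥0∞} {B : ℝ≥0∞} (hB : B ≠ ∞) (hle : ∀ s, h s ≤ B)
    (m : MeanZero h') (hev : ∀ᶠ s in atTop, h s ≤ h' s) : MeanZero h :=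
  .of_forall_eventually_le hB hle fun _ _ => ⟨h', m, hev.mono fun _ hs => hs.trans le_self_add⟩

lemma MeanZero.comp_sub {h : ℝ → ℝ≥0∞} {B : ℝ≥0∞} (hB : B ≠ ∞) (hle : ∀ s, h s ≤ B)
    (m : MeanZero h) {r : ℝ} (hr : 0 ≤ r) : MeanZero (fun s => h (s - r)) := by
  have m' : MeanZero (fun s => (Set.Ici r).indicator (fun s => h (s - r)) s) := by
    refine tendsto_of_tendsto_of_tendsto_of_le_of_le tendsto_const_nhds m (fun _ => zero_le) ?_
    intro T
    refine ENNReal.div_le_div_right ?_ _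
    rw [← lintegral_indicator measurableSet_Icc, ← lintegral_indicator measurableSet_Icc,
      ← lintegral_sub_right_eq_self ((Set.Icc 0 T).indicator h) r]
    refine lintegral_mono fun s => ?_
    by_cases h₁ : s ∈ Set.Icc 0 T
    · rw [Set.indicator_of_mem h₁]
      by_cases h₂ : s ∈ Set.Ici r
      · rw [Set.indicator_of_mem h₂, Set.indicator_of_mem]
        exact ⟨by linarith [h₂.out], by linarith [h₁.2]⟩
      · rw [Set.indicator_of_notMem h₂]; exact zero_le
    · rw [Set.indicator_of_notMem h₁]; exact zero_le
  refine m'.mono hB (fun s => hle _) ?_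
  filter_upwards [eventually_ge_atTop r] with s hs
  rw [Set.indicator_of_mem (Set.mem_Ici.2 hs)]

lemma MeanZero.windowSup_windowSup {h : ℝ → ℝ≥0∞} {B : ℝ≥0∞} (hB : B ≠ ∞) (hle : ∀ s, h s ≤ B)
    (hh : LowerSemicontinuous h) {r : ℝ} (hr : 0 ≤ r) (m : MeanZero (windowSup r h)) :
    MeanZero (windowSup r (windowSup r h)) := by
  have hle' : ∀ s, windowSup r h s ≤ B := fun s => windowSup_le fun τ _ _ => hle τ
  exact (m.add (m.comp_sub hB hle' hr) (hh.windowSup r).measurable).mono hB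
    (fun s => windowSup_le fun τ _ _ => hle' τ)
    (Eventually.of_forall (windowSup_windowSup_le r h))

lemma lintegral_Icc_conv_le {k H : ℝ → ℝ≥0∞} (hk : Measurable k) (hH : Measurable H) (T : ℝ) :
    ∫⁻ s in Set.Icc 0 T, ∫⁻ σ in Set.Ioc 0 s, k σ * H (s - σ) ≤
      (∫⁻ σ in Set.Ioi 0, k σ) * ∫⁻ s in Set.Icc 0 T, H s := by
  have hH' : Measurable ((Set.Icc 0 T).indicator H) := hH.indicator measurableSet_Icc
  calc ∫⁻ s in Set.Icc 0 T, ∫⁻ σ in Set.Ioc 0 s, k σ * H (s - σ)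
      ≤ ∫⁻ s in Set.Icc 0 T, ∫⁻ σ in Set.Ioi 0, k σ * (Set.Icc 0 T).indicator H (s - σ) := by
        refine setLIntegral_mono' measurableSet_Icc fun s hs => ?_
        refine (setLIntegral_mono' measurableSet_Ioc fun σ hσ => ?_).trans
          (lintegral_mono_set Set.Ioc_subset_Ioi_self)
        rw [Set.indicator_of_mem]
        exact ⟨by linarith [hσ.2], by linarith [hσ.1, hs.2]⟩
    _ ≤ ∫⁻ s, ∫⁻ σ in Set.Ioi 0, k σ * (Set.Icc 0 T).indicator H (s - σ) :=
        lintegral_mono' Measure.restrict_le_self le_rfl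
    _ = ∫⁻ σ in Set.Ioi 0, ∫⁻ s, k σ * (Set.Icc 0 T).indicator H (s - σ) := by
        rw [lintegral_lintegral_swap]
        exact ((hk.comp measurable_snd).mul
          (hH'.comp (measurable_fst.sub measurable_snd))).aemeasurable
    _ = ∫⁻ σ in Set.Ioi 0, k σ * ∫⁻ s in Set.Icc 0 T, H s := by
        refine lintegral_congr fun σ => ?_
        rw [lintegral_const_mul (k σ)
            (show Measurable fun s => (Set.Icc 0 T).indicator H (s - σ) from
              hH'.comp (measurable_sub_const σ)),
          lintegral_sub_right_eq_self ((Set.Icc 0 T).indicator H) σ,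
          lintegral_indicator measurableSet_Icc]
    _ = _ := lintegral_mul_const _ hk

lemma MeanZero.conv {k H : ℝ → ℝ≥0∞} (hk : Measurable k) (hH : Measurable H)
    (hki : ∫⁻ σ in Set.Ioi 0, k σ ≠ ∞) (m : MeanZero H) :
    MeanZero (fun s => ∫⁻ σ in Set.Ioc 0 s, k σ * H (s - σ)) := by
  refine tendsto_of_tendsto_of_tendsto_of_le_of_le tendsto_const_nhds (m.const_mul hki)
    (fun _ => zero_le) fun T => ?_
  dsimp only
  rw [lintegral_const_mul' _ _ hki]
  gcongr
  exact lintegral_Icc_conv_le hk hH T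

/-- For bounded measurable functions, vanishing mean can be tested on real averages from `r`. -/
lemma meanZero_iff {h : ℝ → ℝ≥0∞} (hm : Measurable h) {B : ℝ≥0∞} (hB : B ≠ ∞)
    (hle : ∀ s, h s ≤ B) {r : ℝ} (hr : 0 ≤ r) :
    MeanZero h ↔ Tendsto (fun T : ℝ => (1 / T) * ∫ s in r..T, (h s).toReal) atTop (𝓝 0) := by
  have hfin : ∀ s, h s ≠ ∞ := fun s => ne_top_of_le_ne_top hB (hle s)
  have hint : ∀ a b : ℝ, ∫⁻ s in Set.Icc a b, h s ≠ ∞ := fun a b => by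
    refine ne_top_of_le_ne_top (b := B * volume (Set.Icc a b)) (ENNReal.mul_ne_top hB (by simp)) ?_
    rw [← setLIntegral_const]
    exact lintegral_mono fun s => hle s
  have key : Tendsto (fun T : ℝ => (1 / T) * ∫ s in r..T, (h s).toReal) atTop (𝓝 0) ↔
      Tendsto (fun T : ℝ => (∫⁻ s in Set.Icc r T, h s) / ENNReal.ofReal T) atTop (𝓝 0) := by
    have hev : (fun T : ℝ => (∫⁻ s in Set.Icc r T, h s) / ENNReal.ofReal T) =ᶠ[atTop]
        fun T => (∫⁻ s in Set.Icc r T, h s) / ENNReal.ofReal (max T 1) := by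
      filter_upwards [eventually_ge_atTop 1] with T hT
      rw [max_eq_left hT]
    rw [tendsto_congr' hev, ← ENNReal.tendsto_toReal_zero_iff fun T =>
      ENNReal.div_ne_top (hint r T) (by simp)]
    refine tendsto_congr' ?_
    filter_upwards [eventually_ge_atTop 1, eventually_ge_atTop r] with T hT hrT
    rw [max_eq_left hT, ENNReal.toReal_div, ENNReal.toReal_ofReal (by linarith),
      intervalIntegral.integral_of_le hrT,
      integral_toReal hm.aemeasurable (ae_of_all _ fun s => (hfin s).lt_top),
      restrict_Ioc_eq_restrict_Icc]
    ring
  rw [key]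
  constructor
  · intro m
    refine tendsto_of_tendsto_of_tendsto_of_le_of_le tendsto_const_nhds m (fun _ => zero_le) ?_
    intro T
    dsimp only
    gcongr
  · intro m
    have := (tendsto_const_div_ofReal (hint 0 r)).add m
    rw [add_zero] at this
    refine tendsto_of_tendsto_of_tendsto_of_le_of_le tendsto_const_nhds this (fun _ => zero_le) ?_
    intro T
    dsimp only
    rw [← ENNReal.add_div]
    gcongr
    refine (lintegral_mono_set (t := Set.Icc 0 r ∪ Set.Icc r T) ?_).trans
      (lintegral_union_le _ _ _)
    intro s hs
    rcases le_total s r with hc | hc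
    · exact Or.inl ⟨hs.1, hc⟩
    · exact Or.inr ⟨hc, hs.2⟩

/-- The kernel bounding the resolvent family, extended by a constant to negative times. -/
noncomputable def decayKernel (α m c t : ℝ) : ℝ≥0∞ :=
  ENNReal.ofReal (c / (1 + m * (max t 0) ^ α))

lemma decayKernel_continuous {α m : ℝ} (hα : 0 < α) (hm : 0 < m) (c : ℝ) :
    Continuous (decayKernel α m c) := by
  refine ENNReal.continuous_ofReal.comp (continuous_const.div ?_ fun t => ?_)
  · exact continuous_const.add (continuous_const.mul
      ((continuous_id.max continuous_const).rpow_const fun _ => Or.inr hα.le))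
  · positivity

lemma decayKernel_antitone {α m c : ℝ} (hα : 0 < α) (hm : 0 < m) (hc : 0 < c) :
    Antitone (decayKernel α m c) := by
  intro a b hab
  unfold decayKernel
  gcongr

lemma decayKernel_tendsto {α m : ℝ} (hα : 0 < α) (hm : 0 < m) (c : ℝ) :
    Tendsto (decayKernel α m c) atTop (𝓝 0) := by
  rw [← ENNReal.ofReal_zero]
  refine ENNReal.tendsto_ofReal ?_
  refine Tendsto.div_atTop tendsto_const_nhds ?_
  refine tendsto_atTop_add_const_left _ _ (Tendsto.const_mul_atTop hm ?_)
  exact (tendsto_rpow_atTop hα).comp (tendsto_atTop_mono (fun t => le_max_left t 0) tendsto_id)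

lemma lintegral_exp_neg_mul_Ioi {b : ℝ} (hb : 0 < b) :
    ∫⁻ t in Set.Ioi (0 : ℝ), ENNReal.ofReal (Real.exp (-(b * t))) = ENNReal.ofReal (1 / b) := by
  have h := integral_exp_mul_Ioi (neg_neg_of_pos hb) 0
  rw [mul_zero, Real.exp_zero, neg_div_neg_eq] at h
  rw [← h, ofReal_integral_eq_lintegral_ofReal (integrableOn_exp_mul_Ioi (neg_neg_of_pos hb) 0)
    (ae_of_all _ fun _ => (Real.exp_pos _).le)]
  simp only [neg_mul]

lemma lintegral_exp_neg_mul_rpow {p b : ℝ} (hp : 0 < p) (hb : 0 < b) :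
    ∫⁻ x in Set.Ioi (0 : ℝ), ENNReal.ofReal (Real.exp (-b * x ^ p)) =
      ENNReal.ofReal (b ^ (-1 / p) * Real.Gamma (1 / p + 1)) := by
  rw [← integral_exp_neg_mul_rpow hp hb, ofReal_integral_eq_lintegral_ofReal _
    (ae_of_all _ fun _ => (Real.exp_pos _).le)]
  simpa [IntegrableOn] using integrableOn_rpow_mul_exp_neg_mul_rpow (s := 0) (by norm_num) hp hb

lemma lintegral_one_div_one_add_mul_rpow {α m : ℝ} (hα : 1 < α) (hm : 0 < m) :
    ∫⁻ x in Set.Ioi (0 : ℝ), ENNReal.ofReal (1 / (1 + m * x ^ α)) =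
      ENNReal.ofReal (m ^ (-(1 / α)) * Real.pi / (α * Real.sin (Real.pi / α))) := by
  have hα0 : 0 < α := by linarith
  have hlt : 1 / α < 1 := by rw [div_lt_one hα0]; exact hα
  calc ∫⁻ x in Set.Ioi (0 : ℝ), ENNReal.ofReal (1 / (1 + m * x ^ α))
      = ∫⁻ x in Set.Ioi (0 : ℝ), ∫⁻ t in Set.Ioi (0 : ℝ),
          ENNReal.ofReal (Real.exp (-((1 + m * x ^ α) * t))) := by
        refine setLIntegral_congr_fun measurableSet_Ioi fun x hx => ?_
        have : 0 ≤ x ^ α := Real.rpow_nonneg (le_of_lt hx) _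
        exact (lintegral_exp_neg_mul_Ioi (by positivity)).symm
    _ = ∫⁻ t in Set.Ioi (0 : ℝ), ∫⁻ x in Set.Ioi (0 : ℝ),
          ENNReal.ofReal (Real.exp (-((1 + m * x ^ α) * t))) := by
        rw [lintegral_lintegral_swap]
        exact (by fun_prop : Measurable _).aemeasurable
    _ = ∫⁻ t in Set.Ioi (0 : ℝ), ENNReal.ofReal (m ^ (-(1 / α)) * Real.Gamma (1 / α + 1)) *
          ENNReal.ofReal (Real.exp (-t) * t ^ ((1 - 1 / α) - 1)) := by
        refine setLIntegral_congr_fun measurableSet_Ioi fun t ht => ?_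
        have ht : 0 < t := ht
        have hexp : ∀ x : ℝ, ENNReal.ofReal (Real.exp (-((1 + m * x ^ α) * t))) =
            ENNReal.ofReal (Real.exp (-t)) * ENNReal.ofReal (Real.exp (-(m * t) * x ^ α)) := by
          intro x
          rw [← ENNReal.ofReal_mul (Real.exp_pos _).le, ← Real.exp_add]
          ring_nf
        simp_rw [hexp]
        rw [lintegral_const_mul' _ _ ENNReal.ofReal_ne_top,
          lintegral_exp_neg_mul_rpow hα0 (by positivity),
          ← ENNReal.ofReal_mul (Real.exp_pos _).le,
          ← ENNReal.ofReal_mul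
            (mul_nonneg (by positivity) (Real.Gamma_pos_of_pos (by positivity)).le),
          Real.mul_rpow hm.le ht.le, neg_div, sub_sub_cancel_left]
        ring_nf
    _ = ENNReal.ofReal (m ^ (-(1 / α)) * Real.Gamma (1 / α + 1)) *
          ENNReal.ofReal (Real.Gamma (1 - 1 / α)) := by
        rw [lintegral_const_mul' _ _ ENNReal.ofReal_ne_top,
          Real.Gamma_eq_integral (s := 1 - 1 / α) (by linarith), ofReal_integral_eq_lintegral_ofReal
            (Real.GammaIntegral_convergent (by linarith))]
        refine (ae_restrict_iff' measurableSet_Ioi).2 (ae_of_all _ fun x hx => ?_)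
        exact mul_nonneg (Real.exp_pos _).le (Real.rpow_nonneg (le_of_lt hx) _)
    _ = _ := by
        rw [← ENNReal.ofReal_mul
            (mul_nonneg (by positivity) (Real.Gamma_pos_of_pos (by positivity)).le),
          Real.Gamma_add_one (by positivity), mul_assoc, mul_assoc,
          Real.Gamma_mul_Gamma_one_sub, mul_one_div]
        congr 1
        field_simp

lemma lintegral_decayKernel {α m c : ℝ} (hα : 1 < α) (hm : 0 < m) (hc : 0 < c) :
    ∫⁻ x in Set.Ioi (0 : ℝ), decayKernel α m c x =
      ENNReal.ofReal (c * (m ^ (-(1 / α)) * Real.pi / (α * Real.sin (Real.pi / α)))) := by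
  rw [ENNReal.ofReal_mul hc.le, ← lintegral_one_div_one_add_mul_rpow hα hm,
    ← lintegral_const_mul' _ _ ENNReal.ofReal_ne_top]
  refine setLIntegral_congr_fun measurableSet_Ioi fun x hx => ?_
  rw [decayKernel, max_eq_left (le_of_lt hx), ← ENNReal.ofReal_mul hc.le, mul_one_div]

section History

variable {X : Type*} [NormedAddCommGroup X] {r : ℝ}

lemma hist_apply_of_continuous {u : ℝ → X} (hu : Continuous u) (t : ℝ)
    (θ : Set.Icc (-r) (0 : ℝ)) : hist r u t θ = u (t + θ) := by
  have hc : Continuous fun θ : Set.Icc (-r) (0 : ℝ) => u (t + ↑θ) := by fun_prop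
  rw [hist, dif_pos hc]
  rfl

lemma continuous_hist {u : ℝ → X} (hu : Continuous u) : Continuous (hist r u) := by
  let U : C(ℝ × Set.Icc (-r) (0 : ℝ), X) := ⟨fun p => u (p.1 + p.2), by fun_prop⟩
  have : hist r u = U.curry := by
    ext t θ
    exact hist_apply_of_continuous hu t θ
  rw [this]
  exact U.curry.continuous

lemma ContinuousMap.enorm_le_of_forall {K : Type*} [TopologicalSpace K] [CompactSpace K]
    {ψ : C(K, X)} {b : ℝ≥0∞} (h : ∀ θ, ‖ψ θ‖ₑ ≤ b) : ‖ψ‖ₑ ≤ b := by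
  induction b with
  | top => exact le_top
  | coe b =>
    simp only [enorm_le_coe] at h ⊢
    exact (ContinuousMap.norm_le ψ b.2).2 h

lemma BoundedContinuousFunction.enorm_apply_le {K : Type*} [TopologicalSpace K]
    (u : BoundedContinuousFunction K X) (t : K) : ‖u t‖ₑ ≤ ‖u‖ₑ :=
  enorm_le_iff_norm_le.2 (u.norm_coe_le_norm t)

lemma enorm_hist_le (u : BoundedContinuousFunction ℝ X) (t : ℝ) : ‖hist r u t‖ₑ ≤ ‖u‖ₑ :=
  ContinuousMap.enorm_le_of_forall fun θ => by
    rw [hist_apply_of_continuous u.continuous]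
    exact u.enorm_apply_le _

lemma enorm_hist_sub_hist_le (u v : BoundedContinuousFunction ℝ X) (t : ℝ) :
    ‖hist r u t - hist r v t‖ₑ ≤ ‖u - v‖ₑ :=
  ContinuousMap.enorm_le_of_forall fun θ => by
    rw [ContinuousMap.sub_apply, hist_apply_of_continuous u.continuous,
      hist_apply_of_continuous v.continuous]
    exact (u - v).enorm_apply_le _

/-- The size of the `ω`-increment of `u`. -/
noncomputable def increment (ω : ℝ) (u : ℝ → X) (τ : ℝ) : ℝ≥0∞ := ‖u (τ + ω) - u τ‖ₑ

/-- The size of the `ω`-increment of `F`, uniformly over the ball of radius `L`. -/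
noncomputable def incrementUnif {E : Type*} [NormedAddCommGroup E] (ω L : ℝ) (F : ℝ → E → X)
    (τ : ℝ) : ℝ≥0∞ :=
  ⨆ x ∈ {x : E | ‖x‖ ≤ L}, ‖F (τ + ω) x - F τ x‖ₑ

lemma continuous_increment {ω : ℝ} {u : ℝ → X} (hu : Continuous u) : Continuous (increment ω u) :=
  ((hu.comp (continuous_add_const ω)).sub hu).enorm

lemma increment_le (ω : ℝ) (u : BoundedContinuousFunction ℝ X) (τ : ℝ) :
    increment ω u τ ≤ 2 * ‖u‖ₑ := by
  rw [two_mul]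
  exact enorm_sub_le.trans (add_le_add (u.enorm_apply_le _) (u.enorm_apply_le _))

lemma increment_le_add (ω : ℝ) (u v : BoundedContinuousFunction ℝ X) (τ : ℝ) :
    increment ω u τ ≤ increment ω v τ + 2 * ‖u - v‖ₑ := by
  have h : u (τ + ω) - u τ = (v (τ + ω) - v τ) + ((u - v) (τ + ω) - (u - v) τ) := by
    simp only [BoundedContinuousFunction.coe_sub, Pi.sub_apply]; abel
  rw [increment, h]
  exact (enorm_add_le _ _).trans (add_le_add le_rfl (increment_le ω (u - v) τ))

lemma lowerSemicontinuous_incrementUnif {E : Type*} [NormedAddCommGroup E] {ω L : ℝ}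
    {F : ℝ → E → X} (hF : Continuous (Function.uncurry F)) :
    LowerSemicontinuous (incrementUnif ω L F) := by
  refine lowerSemicontinuous_biSup fun x _ => Continuous.lowerSemicontinuous ?_
  exact ((hF.comp ((continuous_add_const ω).prodMk continuous_const)).sub
    (hF.comp (continuous_id.prodMk continuous_const))).enorm

lemma le_incrementUnif {E : Type*} [NormedAddCommGroup E] {ω L : ℝ} (F : ℝ → E → X) (τ : ℝ)
    {x : E} (hx : ‖x‖ ≤ L) : ‖F (τ + ω) x - F τ x‖ₑ ≤ incrementUnif ω L F τ :=
  le_iSup₂_of_le x hx le_rfl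

lemma LipschitzWith.enorm_sub_apply_le {E : Type*} [NormedAddCommGroup E] {L : ℝ≥0} {F : E → X}
    (hF : LipschitzWith L F) (x y : E) : ‖F x - F y‖ₑ ≤ L * ‖x - y‖ₑ := by
  simpa [edist_eq_enorm_sub] using hF x y

lemma LipschitzWith.enorm_apply_le {E : Type*} [NormedAddCommGroup E] {L : ℝ≥0} {F : E → X}
    (hF : LipschitzWith L F) {B : ℝ≥0} (h0 : ‖F 0‖ₑ ≤ B) (x : E) : ‖F x‖ₑ ≤ L * ‖x‖ₑ + B := by
  have h := hF.enorm_sub_apply_le x 0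
  rw [sub_zero] at h
  calc ‖F x‖ₑ = ‖(F x - F 0) + F 0‖ₑ := by rw [sub_add_cancel]
    _ ≤ _ := (enorm_add_le _ _).trans (add_le_add h h0)

lemma incrementUnif_le {E : Type*} [NormedAddCommGroup E] {ω : ℝ} {L : ℝ} {F : ℝ → E → X}
    {K B : ℝ≥0} (hF : ∀ t, LipschitzWith K (F t)) (h0 : ∀ t, ‖F t 0‖ₑ ≤ B) (τ : ℝ) :
    incrementUnif ω L F τ ≤ 2 * (K * ENNReal.ofReal L + B) := by
  refine iSup₂_le fun x hx => ?_
  have hx' : ‖x‖ₑ ≤ ENNReal.ofReal L := by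
    rw [← ofReal_norm]; exact ENNReal.ofReal_le_ofReal hx
  rw [two_mul]
  refine enorm_sub_le.trans (add_le_add ?_ ?_) <;>
  · refine ((hF _).enorm_apply_le (h0 _) x).trans ?_
    gcongr

lemma enorm_hist_increment_le {ω : ℝ} {u : ℝ → X} (hu : Continuous u) (t : ℝ) :
    ‖hist r u (t + ω) - hist r u t‖ₑ ≤ windowSup r (increment ω u) t :=
  ContinuousMap.enorm_le_of_forall fun θ => by
    rw [ContinuousMap.sub_apply, hist_apply_of_continuous hu, hist_apply_of_continuous hu,
      add_right_comm]
    exact le_windowSup (increment ω u) (by linarith [θ.2.1]) (by linarith [θ.2.2])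

lemma enorm_hist_comp_increment_le {ω L : ℝ} {F : ℝ → C(Set.Icc (-r) (0 : ℝ), X) → X} {K : ℝ≥0}
    (hF : ∀ t, LipschitzWith K (F t)) {u : BoundedContinuousFunction ℝ X} (hL : ‖u‖ ≤ L) (t : ℝ) :
    ‖F (t + ω) (hist r u (t + ω)) - F t (hist r u t)‖ₑ ≤
      incrementUnif ω L F t + K * windowSup r (increment ω u) t := by
  rw [← sub_add_sub_cancel _ (F (t + ω) (hist r u t)), add_comm (incrementUnif ω L F t)]
  refine (enorm_add_le _ _).trans (add_le_add ?_ ?_)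
  · refine ((hF _).enorm_sub_apply_le _ _).trans ?_
    gcongr
    exact enorm_hist_increment_le u.continuous t
  · exact le_incrementUnif F t ((enorm_le_iff_norm_le.1 (enorm_hist_le u t)).trans hL)

end History

section MildEquation

variable {X : Type*} [NormedAddCommGroup X] [NormedSpace ℝ X] {r : ℝ}

/-- The right-hand side of the mild formulation, with the convolution written as
`∫_0^t S(σ) f(t-σ, u_{t-σ}) dσ`. -/
noncomputable def mildRHS (r : ℝ) (S : ℝ → X →L[ℝ] X) (x₀ : X)
    (g f : ℝ → C(Set.Icc (-r) (0 : ℝ), X) → X) (u : ℝ → X) (t : ℝ) : X :=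
  S t x₀ + g t (hist r u t) + ∫ σ in (0 : ℝ)..t, S σ (f (t - σ) (hist r u (t - σ)))

/-- Assumptions on the data of the mild equation, for data extended to all real times. -/
structure MildHyp (r : ℝ) (S : ℝ → X →L[ℝ] X) (g f : ℝ → C(Set.Icc (-r) (0 : ℝ), X) → X)
    (k : ℝ → ℝ≥0∞) (Lg Lf Bg Bf κ Ck : ℝ≥0) : Prop where
  continuous_S : ∀ x, Continuous fun t => S t x
  enorm_S_le : ∀ t, ‖S t‖ₑ ≤ k t
  antitone_k : Antitone k
  k_le : ∀ t, k t ≤ Ck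
  tendsto_k : Tendsto k atTop (𝓝 0)
  lintegral_k_le : ∫⁻ σ in Set.Ioi 0, k σ ≤ κ
  continuous_g : Continuous (Function.uncurry g)
  continuous_f : Continuous (Function.uncurry f)
  lipschitz_g : ∀ t, LipschitzWith Lg (g t)
  lipschitz_f : ∀ t, LipschitzWith Lf (f t)
  enorm_g_zero_le : ∀ t, ‖g t 0‖ₑ ≤ Bg
  enorm_f_zero_le : ∀ t, ‖f t 0‖ₑ ≤ Bf

namespace MildHyp

variable {S : ℝ → X →L[ℝ] X} {g f : ℝ → C(Set.Icc (-r) (0 : ℝ), X) → X} {k : ℝ → ℝ≥0∞}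
  {Lg Lf Bg Bf κ Ck : ℝ≥0}

lemma continuous_uncurry_S (h : MildHyp r S g f k Lg Lf Bg Bf κ Ck) :
    Continuous fun p : ℝ × X => S p.1 p.2 := by
  have h' : Continuous fun p : X × ℝ => S p.2 p.1 := by
    refine continuous_prod_of_continuous_lipschitzWith _ Ck h.continuous_S fun t => ?_
    refine (S t).lipschitz.weaken ?_
    exact_mod_cast (h.enorm_S_le t).trans (h.k_le t)
  exact h'.comp continuous_swap

lemma enorm_integral_le (h : MildHyp r S g f k Lg Lf Bg Bf κ Ck) (ψ : ℝ → X) {a b : ℝ}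
    (hab : a ≤ b) :
    ‖∫ σ in a..b, S σ (ψ σ)‖ₑ ≤ ∫⁻ σ in Set.Ioc a b, k σ * ‖ψ σ‖ₑ := by
  rw [intervalIntegral.integral_of_le hab]
  refine (enorm_integral_le_lintegral_enorm _).trans (lintegral_mono fun σ => ?_)
  exact ((S σ).le_opENorm (ψ σ)).trans (by gcongr; exact h.enorm_S_le σ)

lemma enorm_integral_le_of_bound (h : MildHyp r S g f k Lg Lf Bg Bf κ Ck) {ψ : ℝ → X} {t : ℝ}
    (ht : 0 ≤ t) {b : ℝ≥0∞} (hψ : ∀ σ, ‖ψ σ‖ₑ ≤ b) :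
    ‖∫ σ in (0 : ℝ)..t, S σ (ψ σ)‖ₑ ≤ κ * b := by
  refine (h.enorm_integral_le ψ ht).trans ?_
  calc ∫⁻ σ in Set.Ioc 0 t, k σ * ‖ψ σ‖ₑ ≤ ∫⁻ σ in Set.Ioi 0, k σ * b := by
        refine (lintegral_mono fun σ => ?_).trans (lintegral_mono_set Set.Ioc_subset_Ioi_self)
        gcongr
        exact hψ σ
    _ = (∫⁻ σ in Set.Ioi 0, k σ) * b := lintegral_mul_const _ h.antitone_k.measurable
    _ ≤ κ * b := by gcongr; exact h.lintegral_k_le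

lemma continuous_integrand (h : MildHyp r S g f k Lg Lf Bg Bf κ Ck) {u : ℝ → X}
    (hu : Continuous u) :
    Continuous (Function.uncurry fun t σ : ℝ => S σ (f (t - σ) (hist r u (t - σ)))) :=
  h.continuous_uncurry_S.comp (continuous_snd.prodMk (h.continuous_f.comp
    ((continuous_fst.sub continuous_snd).prodMk
      ((continuous_hist hu).comp (continuous_fst.sub continuous_snd)))))

lemma continuous_mildRHS (h : MildHyp r S g f k Lg Lf Bg Bf κ Ck) (x₀ : X) {u : ℝ → X}
    (hu : Continuous u) : Continuous (mildRHS r S x₀ g f u) :=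
  ((h.continuous_S x₀).add (h.continuous_g.comp (continuous_id.prodMk (continuous_hist hu)))).add
    (intervalIntegral.continuous_parametric_intervalIntegral_of_continuous
      (h.continuous_integrand hu) continuous_id)

lemma intervalIntegrable (h : MildHyp r S g f k Lg Lf Bg Bf κ Ck) {u : ℝ → X}
    (hu : Continuous u) (t a b : ℝ) :
    IntervalIntegrable (fun σ => S σ (f (t - σ) (hist r u (t - σ)))) volume a b :=
  ((h.continuous_integrand hu).comp (continuous_const.prodMk continuous_id)).intervalIntegrable _ _

lemma enorm_f_hist_le (h : MildHyp r S g f k Lg Lf Bg Bf κ Ck)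
    (u : BoundedContinuousFunction ℝ X) (t : ℝ) : ‖f t (hist r u t)‖ₑ ≤ Lf * ‖u‖ₑ + Bf :=
  ((h.lipschitz_f t).enorm_apply_le (h.enorm_f_zero_le t) _).trans
    (by gcongr; exact enorm_hist_le u t)

lemma enorm_mildRHS_le (h : MildHyp r S g f k Lg Lf Bg Bf κ Ck) (x₀ : X)
    (u : BoundedContinuousFunction ℝ X) {t : ℝ} (ht : 0 ≤ t) :
    ‖mildRHS r S x₀ g f u t‖ₑ ≤
      Ck * ‖x₀‖ₑ + (Lg * ‖u‖ₑ + Bg) + κ * (Lf * ‖u‖ₑ + Bf) := by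
  refine (enorm_add_le _ _).trans (add_le_add ((enorm_add_le _ _).trans (add_le_add ?_ ?_)) ?_)
  · refine ((S t).le_opENorm x₀).trans ?_
    gcongr
    exact (h.enorm_S_le t).trans (h.k_le t)
  · refine ((h.lipschitz_g t).enorm_apply_le (h.enorm_g_zero_le t) _).trans ?_
    gcongr
    exact enorm_hist_le u t
  · exact h.enorm_integral_le_of_bound (ψ := fun σ => f (t - σ) (hist r u (t - σ))) ht
      fun σ => h.enorm_f_hist_le u _

lemma enorm_mildRHS_sub_le (h : MildHyp r S g f k Lg Lf Bg Bf κ Ck) (x₀ : X)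
    (u v : BoundedContinuousFunction ℝ X) {t : ℝ} (ht : 0 ≤ t) :
    ‖mildRHS r S x₀ g f u t - mildRHS r S x₀ g f v t‖ₑ ≤
      (Lg + κ * Lf : ℝ≥0) * ‖u - v‖ₑ := by
  have hint : (∫ σ in (0 : ℝ)..t, S σ (f (t - σ) (hist r u (t - σ)))) -
      (∫ σ in (0 : ℝ)..t, S σ (f (t - σ) (hist r v (t - σ)))) =
      ∫ σ in (0 : ℝ)..t, S σ (f (t - σ) (hist r u (t - σ)) - f (t - σ) (hist r v (t - σ))) := by
    rw [← intervalIntegral.integral_sub (h.intervalIntegrable u.continuous t 0 t)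
      (h.intervalIntegrable v.continuous t 0 t)]
    simp only [map_sub]
  have heq : mildRHS r S x₀ g f u t - mildRHS r S x₀ g f v t =
      (g t (hist r u t) - g t (hist r v t)) +
      ∫ σ in (0 : ℝ)..t, S σ (f (t - σ) (hist r u (t - σ)) - f (t - σ) (hist r v (t - σ))) := by
    rw [← hint, mildRHS, mildRHS]; abel
  have hlip : ∀ {F : ℝ → C(Set.Icc (-r) (0 : ℝ), X) → X} {K : ℝ≥0},
      (∀ s, LipschitzWith K (F s)) → ∀ s,
      ‖F s (hist r u s) - F s (hist r v s)‖ₑ ≤ K * ‖u - v‖ₑ := fun hF s =>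
    ((hF s).enorm_sub_apply_le _ _).trans (by gcongr; exact enorm_hist_sub_hist_le u v s)
  rw [heq, ENNReal.coe_add, ENNReal.coe_mul, add_mul, mul_assoc]
  refine (enorm_add_le _ _).trans (add_le_add (hlip h.lipschitz_g t) ?_)
  exact h.enorm_integral_le_of_bound
    (ψ := fun σ => f (t - σ) (hist r u (t - σ)) - f (t - σ) (hist r v (t - σ))) ht
    fun σ => hlip h.lipschitz_f _

lemma increment_mildRHS_le (h : MildHyp r S g f k Lg Lf Bg Bf κ Ck) (x₀ : X) {ω : ℝ} (hω : 0 ≤ ω)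
    (u : BoundedContinuousFunction ℝ X) {L : ℝ} (hL : ‖u‖ ≤ L) {t : ℝ} (ht : 0 ≤ t) :
    increment ω (mildRHS r S x₀ g f u) t ≤
      (2 * ‖x₀‖ₑ + (Lf * ‖u‖ₑ + Bf) * ENNReal.ofReal ω) * k t +
      (incrementUnif ω L g t + Lg * windowSup r (increment ω u) t) +
      ∫⁻ σ in Set.Ioc 0 t, k σ *
        (incrementUnif ω L f (t - σ) + Lf * windowSup r (increment ω u) (t - σ)) := by
  set A : ℝ → X := fun s => f s (hist r u s) with hA
  have hsplit :
      (∫ σ in (0 : ℝ)..(t + ω), S σ (A (t + ω - σ))) - ∫ σ in (0 : ℝ)..t, S σ (A (t - σ)) =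
      (∫ σ in t..(t + ω), S σ (A (t + ω - σ))) +
        ∫ σ in (0 : ℝ)..t, S σ (A (t - σ + ω) - A (t - σ)) := by
    rw [← intervalIntegral.integral_add_adjacent_intervals
      (h.intervalIntegrable u.continuous (t + ω) 0 t)
      (h.intervalIntegrable u.continuous (t + ω) t (t + ω)), add_sub_right_comm, add_comm,
      ← intervalIntegral.integral_sub (h.intervalIntegrable u.continuous (t + ω) 0 t)
      (h.intervalIntegrable u.continuous t 0 t)]
    simp only [map_sub, hA, sub_add_eq_add_sub]
  have heq : mildRHS r S x₀ g f u (t + ω) - mildRHS r S x₀ g f u t =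
      ((S (t + ω) x₀ - S t x₀) + ∫ σ in t..(t + ω), S σ (A (t + ω - σ))) +
      (g (t + ω) (hist r u (t + ω)) - g t (hist r u t)) +
      ∫ σ in (0 : ℝ)..t, S σ (A (t - σ + ω) - A (t - σ)) := by
    have : ∀ a b c a' b' c' d e : X, c - c' = d + e →
        a + b + c - (a' + b' + c') = (a - a' + d) + (b - b') + e := by
      intro a b c a' b' c' d e hc
      rw [show a + b + c - (a' + b' + c') = (a - a') + (b - b') + (c - c') by abel, hc]
      abel
    exact this _ _ _ _ _ _ _ _ hsplit
  rw [increment, heq]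
  refine (enorm_add_le _ _).trans (add_le_add ((enorm_add_le _ _).trans (add_le_add ?_ ?_)) ?_)
  · rw [add_mul]
    refine (enorm_add_le _ _).trans (add_le_add ?_ ?_)
    · rw [two_mul, add_mul, mul_comm ‖x₀‖ₑ]
      refine enorm_sub_le.trans (add_le_add ?_ ?_)
      · refine ((S _).le_opENorm x₀).trans ?_
        gcongr
        exact (h.enorm_S_le _).trans (h.antitone_k (by linarith))
      · refine ((S _).le_opENorm x₀).trans ?_
        gcongr
        exact h.enorm_S_le _
    · refine (h.enorm_integral_le _ (by linarith)).trans ?_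
      calc ∫⁻ σ in Set.Ioc t (t + ω), k σ * ‖A (t + ω - σ)‖ₑ
          ≤ ∫⁻ σ in Set.Ioc t (t + ω), k t * (Lf * ‖u‖ₑ + Bf) := by
            refine setLIntegral_mono' measurableSet_Ioc fun σ hσ => ?_
            gcongr
            · exact h.antitone_k hσ.1.le
            · exact h.enorm_f_hist_le u _
        _ = _ := by
            rw [setLIntegral_const, Real.volume_Ioc, add_sub_cancel_left]
            ring
  · exact enorm_hist_comp_increment_le h.lipschitz_g hL t
  · refine (h.enorm_integral_le _ ht).trans (lintegral_mono fun σ => ?_)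
    gcongr
    exact enorm_hist_comp_increment_le h.lipschitz_f hL _

end MildHyp

end MildEquation

section PseudoPeriodic

variable {X : Type*} [NormedAddCommGroup X]

lemma lowerSemicontinuous_add_mul {a b : ℝ → ℝ≥0∞} (ha : LowerSemicontinuous a)
    (hb : LowerSemicontinuous b) (K : ℝ≥0) : LowerSemicontinuous fun t => a t + K * b t :=
  ha.add ((ENNReal.continuous_const_mul ENNReal.coe_ne_top).comp_lowerSemicontinuous hb
    fun _ _ hxy => by dsimp only; gcongr)

lemma MeanZero.windowSup_add_mul {a b : ℝ → ℝ≥0∞} {A B : ℝ≥0∞} (hA : A ≠ ∞) (hB : B ≠ ∞)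
    (haA : ∀ t, a t ≤ A) (hbB : ∀ t, b t ≤ B) (ha : LowerSemicontinuous a) {r : ℝ} (K : ℝ≥0)
    (ma : MeanZero (windowSup r a)) (mb : MeanZero (windowSup r b)) :
    MeanZero (windowSup r fun t => a t + K * b t) := by
  refine (ma.add (mb.const_mul (c := K) ENNReal.coe_ne_top) (ha.windowSup r).measurable).mono
    (B := A + K * B) (by finiteness) (fun s => windowSup_le fun τ _ _ => ?_)
    (Eventually.of_forall fun s => windowSup_le fun τ h₁ h₂ => ?_)
  · gcongr
    exacts [haA τ, hbB τ]
  · gcongr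
    exacts [le_windowSup a h₁ h₂, le_windowSup b h₁ h₂]

lemma setLIntegral_conv_le_windowSup (k H : ℝ → ℝ≥0∞) {r s τ : ℝ} (h₁ : s - r ≤ τ) (h₂ : τ ≤ s) :
    ∫⁻ σ in Set.Ioc 0 τ, k σ * H (τ - σ) ≤
      ∫⁻ σ in Set.Ioc 0 s, k σ * windowSup r H (s - σ) := by
  refine (lintegral_mono fun σ => ?_).trans (lintegral_mono_set (Set.Ioc_subset_Ioc_right h₂))
  gcongr
  exact le_windowSup H (by linarith) (by linarith)

lemma ENNReal.toReal_biSup {ι : Type*} {s : Set ι} {h : ι → ℝ≥0∞} (hh : ∀ i ∈ s, h i ≠ ∞) :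
    (⨆ i ∈ s, h i).toReal = ⨆ i ∈ s, (h i).toReal := by
  have hp : ∀ i, (⨆ _ : i ∈ s, h i) ≠ ∞ := fun i => by
    by_cases hi : i ∈ s <;> simp [hi, hh]
  rw [ENNReal.toReal_iSup hp]
  exact iSup_congr fun i => ENNReal.toReal_iSup fun hi => hh i hi

lemma isClosed_meanZero_increment (ω r : ℝ) :
    IsClosed {u : BoundedContinuousFunction ℝ X | MeanZero (windowSup r (increment ω u))} := by
  refine isClosed_of_closure_subset fun u hu => ?_
  refine MeanZero.of_forall_eventually_le (B := 2 * ‖u‖ₑ) (by finiteness)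
    (fun s => windowSup_le fun τ _ _ => increment_le ω u τ) fun ε hε => ?_
  obtain ⟨v, hv, huv⟩ := EMetric.mem_closure_iff.1 hu (ε / 2) (ENNReal.half_pos hε.ne')
  refine ⟨_, hv, Eventually.of_forall fun s => windowSup_le fun τ h₁ h₂ => ?_⟩
  refine (increment_le_add ω u v τ).trans (add_le_add (le_windowSup _ h₁ h₂) ?_)
  rw [edist_eq_enorm_sub] at huv
  calc 2 * ‖u - v‖ₑ ≤ 2 * (ε / 2) := by gcongr
    _ = ε := ENNReal.mul_div_cancel (by norm_num) (by norm_num)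

variable {r : ℝ}

lemma meanZero_windowSup_hist {F : ℝ → C(Set.Icc (-r) (0 : ℝ), X) → X} {K B : ℝ≥0}
    (hF : Continuous (Function.uncurry F)) (hK : ∀ t, LipschitzWith K (F t))
    (hB : ∀ t, ‖F t 0‖ₑ ≤ B) (hr : 0 ≤ r) {ω L : ℝ}
    (mF : MeanZero (windowSup r (incrementUnif ω L F)))
    {u : BoundedContinuousFunction ℝ X} (mu : MeanZero (windowSup r (increment ω u))) :
    MeanZero (windowSup r fun t => incrementUnif ω L F t + K * windowSup r (increment ω u) t) :=
  MeanZero.windowSup_add_mul (A := 2 * (K * ENNReal.ofReal L + B)) (B := 2 * ‖u‖ₑ)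
    (by finiteness) (by finiteness) (incrementUnif_le hK hB)
    (fun s => windowSup_le fun τ _ _ => increment_le ω u τ)
    (lowerSemicontinuous_incrementUnif hF) K mF
    (mu.windowSup_windowSup (B := 2 * ‖u‖ₑ) (by finiteness) (increment_le ω u)
      (continuous_increment u.continuous).lowerSemicontinuous hr)

lemma lowerSemicontinuous_hist {F : ℝ → C(Set.Icc (-r) (0 : ℝ), X) → X}
    (hF : Continuous (Function.uncurry F)) (K : ℝ≥0) (ω L : ℝ)
    (u : BoundedContinuousFunction ℝ X) :
    LowerSemicontinuous fun t =>
      incrementUnif ω L F t + K * windowSup r (increment ω u) t :=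
  lowerSemicontinuous_add_mul (lowerSemicontinuous_incrementUnif hF)
    ((continuous_increment u.continuous).lowerSemicontinuous.windowSup r) K

end PseudoPeriodic

namespace MildHyp

variable {X : Type*} [NormedAddCommGroup X] [NormedSpace ℝ X] {r : ℝ}
  {S : ℝ → X →L[ℝ] X} {g f : ℝ → C(Set.Icc (-r) (0 : ℝ), X) → X} {k : ℝ → ℝ≥0∞}
  {Lg Lf Bg Bf κ Ck : ℝ≥0}

lemma meanZero_increment_mildRHS (h : MildHyp r S g f k Lg Lf Bg Bf κ Ck) (x₀ : X) (hr : 0 ≤ r)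
    {ω : ℝ} (hω : 0 ≤ ω)
    (mg : ∀ L > 0, MeanZero (windowSup r (incrementUnif ω L g)))
    (mf : ∀ L > 0, MeanZero (windowSup r (incrementUnif ω L f)))
    {u v : BoundedContinuousFunction ℝ X} (mu : MeanZero (windowSup r (increment ω u)))
    (hv : ∀ t ≥ 0, v t = mildRHS r S x₀ g f u t) :
    MeanZero (windowSup r (increment ω v)) := by
  have hL : 0 < ‖u‖ + 1 := by positivity
  set L := ‖u‖ + 1
  set Hg : ℝ → ℝ≥0∞ := fun t => incrementUnif ω L g t + Lg * windowSup r (increment ω u) t with hHg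
  set Hf : ℝ → ℝ≥0∞ := fun t => incrementUnif ω L f t + Lf * windowSup r (increment ω u) t with hHf
  set c : ℝ≥0∞ := 2 * ‖x₀‖ₑ + (Lf * ‖u‖ₑ + Bf) * ENNReal.ofReal ω with hc
  have hcfin : c ≠ ∞ := by rw [hc]; finiteness
  have mHg : MeanZero (windowSup r Hg) := meanZero_windowSup_hist h.continuous_g h.lipschitz_g
    h.enorm_g_zero_le hr (mg L hL) mu
  have mHf : MeanZero (windowSup r Hf) := meanZero_windowSup_hist h.continuous_f h.lipschitz_f
    h.enorm_f_zero_le hr (mf L hL) mu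
  have hki : ∫⁻ σ in Set.Ioi 0, k σ ≠ ∞ := ne_top_of_le_ne_top ENNReal.coe_ne_top h.lintegral_k_le
  have mtot := mHg.add (mHf.conv h.antitone_k.measurable
    ((lowerSemicontinuous_hist h.continuous_f Lf ω L u).windowSup r).measurable hki)
    ((lowerSemicontinuous_hist h.continuous_g Lg ω L u).windowSup r).measurable
  refine MeanZero.of_forall_eventually_le (B := 2 * ‖v‖ₑ) (by finiteness)
    (fun s => windowSup_le fun τ _ _ => increment_le ω v τ) fun ε hε => ⟨_, mtot, ?_⟩
  have hk0 : Tendsto (fun s => c * k (s - r)) atTop (𝓝 0) := by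
    have := ENNReal.Tendsto.const_mul (a := c)
      (h.tendsto_k.comp (tendsto_atTop_add_const_right atTop (-r) tendsto_id)) (Or.inr hcfin)
    simpa [sub_eq_add_neg, Function.comp_def] using this
  filter_upwards [ENNReal.tendsto_nhds_zero.1 hk0 ε hε, eventually_ge_atTop r] with s hs hsr
  refine windowSup_le fun τ h₁ h₂ => ?_
  have hτ : 0 ≤ τ := by linarith
  have hinc : increment ω v τ = increment ω (mildRHS r S x₀ g f u) τ := by
    rw [increment, increment, hv τ hτ, hv (τ + ω) (by linarith)]
  rw [hinc, add_comm _ ε, ← add_assoc]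
  refine (h.increment_mildRHS_le x₀ hω u (by simp [L] : ‖u‖ ≤ L) hτ).trans ?_
  refine add_le_add (add_le_add ?_ ?_) ?_
  · exact le_trans (by gcongr; exact h.antitone_k h₁) hs
  · exact le_windowSup Hg h₁ h₂
  · exact setLIntegral_conv_le_windowSup k Hf h₁ h₂

/-- The mild equation extended to all times, with forcing term `p`, has a unique bounded continuous
solution, and this solution is pseudo S-asymptotically periodic. -/
theorem exists_unique [CompleteSpace X] (h : MildHyp r S g f k Lg Lf Bg Bf κ Ck) (x₀ : X)
    (hr : 0 ≤ r) {ω : ℝ} (hω : 0 ≤ ω) (hlt : Lg + κ * Lf < 1)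
    (mg : ∀ L > 0, MeanZero (windowSup r (incrementUnif ω L g)))
    (mf : ∀ L > 0, MeanZero (windowSup r (incrementUnif ω L f)))
    (p : BoundedContinuousFunction ℝ X) (hp : ∀ t ≥ 0, p t = 0) :
    ∃ u : BoundedContinuousFunction ℝ X,
      (∀ t, u t = p t + mildRHS r S x₀ g f u (max t 0)) ∧
      MeanZero (windowSup r (increment ω u)) ∧
      ∀ v : BoundedContinuousFunction ℝ X,
        (∀ t, v t = p t + mildRHS r S x₀ g f v (max t 0)) → v = u := by
  let Φ : BoundedContinuousFunction ℝ X → BoundedContinuousFunction ℝ X := fun u =>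
    BoundedContinuousFunction.ofNormedAddCommGroup
      (fun t => p t + mildRHS r S x₀ g f u (max t 0))
      (p.continuous.add ((h.continuous_mildRHS x₀ u.continuous).comp
        (continuous_id.max continuous_const)))
      (‖p‖ + (Ck * ‖x₀‖ₑ + (Lg * ‖u‖ₑ + Bg) + κ * (Lf * ‖u‖ₑ + Bf)).toReal)
      (fun t => (norm_add_le _ _).trans (add_le_add (p.norm_coe_le_norm t) (by
        rw [← toReal_enorm]
        exact ENNReal.toReal_mono (by finiteness) (h.enorm_mildRHS_le x₀ u (le_max_right t 0)))))
  have hΦ : ∀ u t, Φ u t = p t + mildRHS r S x₀ g f u (max t 0) := fun _ _ => rfl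
  have hcontr : ContractingWith (Lg + κ * Lf) Φ := by
    refine ⟨hlt, fun u v => ?_⟩
    rw [BoundedContinuousFunction.edist_eq_iSup]
    refine iSup_le fun t => ?_
    rw [hΦ, hΦ, edist_add_left, edist_eq_enorm_sub, edist_eq_enorm_sub]
    exact h.enorm_mildRHS_sub_le x₀ u v (le_max_right t 0)
  have hiter : ∀ n, MeanZero (windowSup r (increment ω (Φ^[n] 0))) := by
    intro n
    induction n with
    | zero =>
      have : windowSup r (increment ω ((Φ^[0] 0 : BoundedContinuousFunction ℝ X) : ℝ → X)) =
          fun _ => 0 := by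
        ext s
        simp [windowSup, increment]
      rw [this]
      simp [MeanZero]
    | succ n ih =>
      rw [Function.iterate_succ_apply']
      refine h.meanZero_increment_mildRHS x₀ hr hω mg mf ih fun t ht => ?_
      rw [hΦ, hp t ht, zero_add, max_eq_left ht]
  refine ⟨ContractingWith.fixedPoint Φ hcontr, fun t => ?_, ?_, fun v hv => ?_⟩
  · conv_lhs => rw [← hcontr.fixedPoint_isFixedPt.eq]
    exact hΦ _ t
  · exact (isClosed_meanZero_increment ω r).mem_of_tendsto (hcontr.tendsto_iterate_fixedPoint 0)
      (Eventually.of_forall hiter)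
  · refine hcontr.fixedPoint_unique ?_
    ext t
    rw [hΦ, hv t]

end MildHyp

section Bridge

variable {X : Type*} [NormedAddCommGroup X]

lemma pseudoPeriodic_of_meanZero {ω r : ℝ} (hr : 0 ≤ r) {u : BoundedContinuousFunction ℝ X}
    (m : MeanZero (windowSup r (increment ω u))) : PSAPclass ω r u := by
  have hle : ∀ s, windowSup r (increment ω u) s ≤ 2 * ‖u‖ₑ :=
    fun s => windowSup_le fun τ _ _ => increment_le ω u τ
  have key := (meanZero_iff ((continuous_increment
    u.continuous).lowerSemicontinuous.windowSup r).measurable (by finiteness) hle hr).1 m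
  refine key.congr fun T => ?_
  congr 2
  ext s
  rw [windowSup, ENNReal.toReal_biSup (h := increment ω u) fun τ _ => enorm_ne_top]
  simp only [increment, toReal_enorm]

lemma meanZero_incrementUnif_extend {E : Type*} [NormedAddCommGroup E] {ω r : ℝ} (hr : 0 ≤ r)
    (hω : 0 ≤ ω) {F : ℝ → E → X} (hF : PSAPunif ω r F) {K B : ℝ≥0}
    (hc : Continuous (Function.uncurry fun t => F (max t 0)))
    (hK : ∀ t ≥ 0, LipschitzWith K (F t)) (h0 : ∀ t ≥ 0, ‖F t 0‖ₑ ≤ B) {L : ℝ} (hL : 0 < L) :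
    MeanZero (windowSup r (incrementUnif ω L fun t => F (max t 0))) := by
  have hle := incrementUnif_le (F := fun t => F (max t 0)) (ω := ω) (L := L)
    (fun t => hK _ (le_max_right t 0)) (fun t => h0 _ (le_max_right t 0))
  have hfin : (2 * (K * ENNReal.ofReal L + B) : ℝ≥0∞) ≠ ∞ := by finiteness
  refine (meanZero_iff ((lowerSemicontinuous_incrementUnif hc).windowSup r).measurable hfin
    (fun s => windowSup_le fun τ _ _ => hle τ) hr).2 ((hF L hL).congr' ?_)
  filter_upwards [eventually_ge_atTop r] with T hT
  congr 1
  refine intervalIntegral.integral_congr fun s hs => ?_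
  rw [Set.uIcc_of_le hT] at hs
  rw [windowSup, ENNReal.toReal_biSup fun τ _ => ne_top_of_le_ne_top hfin (hle τ)]
  refine iSup_congr fun τ => iSup_congr fun hτ => ?_
  have hτ0 : 0 ≤ τ := by linarith [hs.1, hτ.1]
  rw [incrementUnif, ENNReal.toReal_biSup fun x _ => enorm_ne_top]
  simp only [Set.mem_ofPred_eq, toReal_enorm, max_eq_left hτ0, max_eq_left (add_nonneg hτ0 hω)]

lemma hist_congr {r : ℝ} {u v : ℝ → X} {t : ℝ}
    (h : ∀ s, t - r ≤ s → s ≤ t → u s = v s) : hist r u t = hist r v t := by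
  have : (fun θ : Set.Icc (-r) (0 : ℝ) => u (t + θ)) =
      fun θ : Set.Icc (-r) (0 : ℝ) => v (t + θ) :=
    funext fun θ => h _ (by linarith [θ.2.1]) (by linarith [θ.2.2])
  unfold hist
  by_cases hc : Continuous fun θ : Set.Icc (-r) (0 : ℝ) => u (t + θ)
  · rw [dif_pos hc, dif_pos (this ▸ hc)]
    exact ContinuousMap.ext (congrFun this)
  · rw [dif_neg hc, dif_neg (this ▸ hc)]

lemma mildRHS_congr [NormedSpace ℝ X] {r : ℝ} {S : ℝ → X →L[ℝ] X} {x₀ : X}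
    {g f : ℝ → C(Set.Icc (-r) (0 : ℝ), X) → X} {u v : ℝ → X} {t : ℝ} (ht : 0 ≤ t)
    (h : ∀ s, -r ≤ s → u s = v s) : mildRHS r S x₀ g f u t = mildRHS r S x₀ g f v t := by
  have hh : ∀ s, 0 ≤ s → hist r u s = hist r v s := fun s hs =>
    hist_congr fun s' h₁ _ => h s' (by linarith)
  rw [mildRHS, mildRHS, hh t ht]
  congr 1
  refine intervalIntegral.integral_congr fun σ hσ => ?_
  rw [Set.uIcc_of_le ht] at hσ
  rw [hh (t - σ) (by linarith [hσ.2])]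

lemma mildRHS_extend [NormedSpace ℝ X] {r : ℝ} {S : ℝ → X →L[ℝ] X} {x₀ : X}
    {g f : ℝ → C(Set.Icc (-r) (0 : ℝ), X) → X} {u : ℝ → X} {t : ℝ} (ht : 0 ≤ t) :
    mildRHS r (fun t => S (max t 0)) x₀ (fun t => g (max t 0)) (fun t => f (max t 0)) u t =
      S t x₀ + g t (hist r u t) + ∫ s in (0 : ℝ)..t, S (t - s) (f s (hist r u s)) := by
  rw [mildRHS, max_eq_left ht]
  congr 1
  have := intervalIntegral.integral_comp_sub_left (a := 0) (b := t)
    (fun s => S (t - s) (f s (hist r u s))) t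
  rw [sub_self, sub_zero] at this
  rw [← this]
  refine intervalIntegral.integral_congr fun σ hσ => ?_
  rw [Set.uIcc_of_le ht] at hσ
  rw [max_eq_left hσ.1, max_eq_left (by linarith [hσ.2]), sub_sub_cancel]

/-- The initial history minus its final value, extended to the whole line. -/
noncomputable def initialProfile {r : ℝ} (hr : 0 ≤ r) (φ : C(Set.Icc (-r) (0 : ℝ), X)) :
    BoundedContinuousFunction ℝ X :=
  BoundedContinuousFunction.compContinuous (BoundedContinuousFunction.mkOfCompact φ)
      ⟨Set.projIcc (-r) 0 (by linarith), continuous_projIcc⟩ -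
    BoundedContinuousFunction.const ℝ (φ ⟨0, Set.right_mem_Icc.mpr (by linarith)⟩)

lemma initialProfile_apply {r : ℝ} (hr : 0 ≤ r) (φ : C(Set.Icc (-r) (0 : ℝ), X)) (t : ℝ) :
    initialProfile hr φ t = φ (Set.projIcc (-r) 0 (by linarith) t) -
      φ ⟨0, Set.right_mem_Icc.mpr (by linarith)⟩ := rfl

lemma initialProfile_of_nonneg {r : ℝ} (hr : 0 ≤ r) (φ : C(Set.Icc (-r) (0 : ℝ), X)) {t : ℝ}
    (ht : 0 ≤ t) : initialProfile hr φ t = 0 := by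
  rw [initialProfile_apply, Set.projIcc_of_right_le _ ht, sub_self]

variable [NormedSpace ℝ X] {r : ℝ} {S : ℝ → X →L[ℝ] X} {φ : C(Set.Icc (-r) (0 : ℝ), X)}
  {g f : ℝ → C(Set.Icc (-r) (0 : ℝ), X) → X}

lemma isMildSolution_of_extended_eq (hr : 0 ≤ r) (hS0 : S 0 = 1) {K : ℝ≥0}
    (hg : LipschitzWith K (g 0)) (hK : K < 1)
    {u : BoundedContinuousFunction ℝ X}
    (hu : ∀ t, u t = initialProfile hr φ t +
      mildRHS r (fun t => S (max t 0)) (φ ⟨0, Set.right_mem_Icc.mpr (by linarith)⟩ - g 0 φ)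
        (fun t => g (max t 0)) (fun t => f (max t 0)) u (max t 0)) :
    IsMildSolution r (Set.right_mem_Icc.mpr (by linarith)) S φ g f u := by
  have hneg : ∀ θ : Set.Icc (-r) (0 : ℝ), u θ = φ θ + (g 0 (hist r u 0) - g 0 φ) := fun θ => by
    rw [hu, initialProfile_apply, max_eq_right θ.2.2, mildRHS_extend le_rfl, Set.projIcc_val, hS0,
      intervalIntegral.integral_same]
    simp only [one_apply_eq_self]
    abel
  have hdiff : ‖hist r u 0 - φ‖ ≤ ‖g 0 (hist r u 0) - g 0 φ‖ := by
    refine (ContinuousMap.norm_le _ (norm_nonneg _)).2 fun θ => ?_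
    rw [ContinuousMap.sub_apply, hist_apply_of_continuous u.continuous, zero_add, hneg,
      add_sub_cancel_left]
  have hgd : ‖g 0 (hist r u 0) - g 0 φ‖ ≤ K * ‖hist r u 0 - φ‖ := by
    simpa [dist_eq_norm] using hg.dist_le_mul (hist r u 0) φ
  have hK' : (K : ℝ) < 1 := by exact_mod_cast hK
  have hzero : g 0 (hist r u 0) - g 0 φ = 0 := by
    rw [← norm_le_zero_iff]
    nlinarith [norm_nonneg (hist r u 0 - φ), K.coe_nonneg]
  refine ⟨u.continuous.continuousOn, ⟨‖u‖, fun t _ => u.norm_coe_le_norm t⟩, fun θ => ?_,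
    fun t ht => ?_⟩
  · rw [hneg, hzero, add_zero]
  · rw [hu, initialProfile_of_nonneg hr φ ht, zero_add, max_eq_left ht, mildRHS_extend ht]

lemma IsMildSolution.exists_extension (hr : 0 ≤ r) {v : ℝ → X}
    (hv : IsMildSolution r (Set.right_mem_Icc.mpr (by linarith)) S φ g f v) :
    ∃ w : BoundedContinuousFunction ℝ X, (∀ t ≥ -r, w t = v t) ∧
      ∀ t, w t = initialProfile hr φ t +
        mildRHS r (fun t => S (max t 0)) (φ ⟨0, Set.right_mem_Icc.mpr (by linarith)⟩ - g 0 φ)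
          (fun t => g (max t 0)) (fun t => f (max t 0)) w (max t 0) := by
  obtain ⟨hc, ⟨B, hB⟩, hφ, heq⟩ := hv
  let w : BoundedContinuousFunction ℝ X := BoundedContinuousFunction.ofNormedAddCommGroup
    (fun t => v (max t (-r)))
    (hc.comp_continuous (continuous_id.max continuous_const) fun t => le_max_right t (-r))
    B (fun t => hB _ (le_max_right t (-r)))
  have hw : ∀ t, w t = v (max t (-r)) := fun _ => rfl
  have hwv : ∀ t ≥ -r, w t = v t := fun t ht => by rw [hw, max_eq_left ht]
  refine ⟨w, hwv, fun t => ?_⟩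
  rw [mildRHS_congr (le_max_right t 0) hwv, mildRHS_extend (le_max_right t 0),
    ← heq _ (le_max_right t 0)]
  rcases le_total 0 t with ht | ht
  · rw [initialProfile_of_nonneg hr φ ht, zero_add, max_eq_left ht, hwv t (by linarith)]
  · have h0 := hφ ⟨0, Set.right_mem_Icc.mpr (by linarith)⟩
    have h1 := hφ (Set.projIcc (-r) 0 (by linarith) t)
    rw [max_eq_right ht, initialProfile_apply, hw, ← h0, ← h1, sub_add_cancel, Set.coe_projIcc,
      min_eq_right ht, max_comm]

lemma continuous_uncurry_extend {E Y : Type*} [TopologicalSpace E] [TopologicalSpace Y]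
    {F : ℝ → E → Y}
    (hF : ContinuousOn (fun p : ℝ × E => F p.1 p.2) (Set.Ici 0 ×ˢ Set.univ)) :
    Continuous (Function.uncurry fun t => F (max t 0)) :=
  hF.comp_continuous (f := fun p : ℝ × E => (max p.1 0, p.2)) (by fun_prop)
    fun p => ⟨le_max_right p.1 0, Set.mem_univ _⟩

end Bridge

/-- Corollary 3.2: under hypotheses (H₁), (H₂) and the smallness
condition `L_g + CM L_f |μ|^{−1/α}π/(α sin(π/α)) < 1`, system (1.2) has a unique mild
solution `u` with `u|_{[0,∞)} ∈ PSAP_{ω,r}(X)`. -/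
theorem existence_uniqueness_cor32 {X : Type*} [NormedAddCommGroup X] [NormedSpace ℝ X]
    [CompleteSpace X]
    (α μ C M r ω : ℝ) (hα1 : 1 < α) (hα2 : α < 2) (hμ : μ < 0) (hC : 0 < C) (hM : 0 < M)
    (hr : 0 < r) (hω : 0 < ω)
    (S : ℝ → X →L[ℝ] X)
    (hScont : ∀ x : X, ContinuousOn (fun t => S t x) (Set.Ici 0))
    (hS0 : S 0 = 1)
    (hSb : ∀ t ≥ (0:ℝ), ‖S t‖ ≤ C * M / (1 + |μ| * t ^ α))
    (φ : C(Set.Icc (-r) (0:ℝ), X))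
    (g f : ℝ → C(Set.Icc (-r) (0:ℝ), X) → X)
    (hgcont : ContinuousOn (fun p : ℝ × C(Set.Icc (-r) (0:ℝ), X) => g p.1 p.2)
      (Set.Ici 0 ×ˢ Set.univ))
    (hfcont : ContinuousOn (fun p : ℝ × C(Set.Icc (-r) (0:ℝ), X) => f p.1 p.2)
      (Set.Ici 0 ×ˢ Set.univ))
    (hgP : PSAPunif ω r g) (hfP : PSAPunif ω r f)
    (hg0 : ∃ B, ∀ t ≥ (0:ℝ), ‖g t 0‖ ≤ B) (hf0 : ∃ B, ∀ t ≥ (0:ℝ), ‖f t 0‖ ≤ B)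
    (Lg Lf : ℝ) (hLg : 0 < Lg) (hLf : 0 < Lf)
    (hgLip : ∀ t ≥ (0:ℝ), ∀ ψ₁ ψ₂ : C(Set.Icc (-r) (0:ℝ), X),
      ‖g t ψ₁ - g t ψ₂‖ ≤ Lg * ‖ψ₁ - ψ₂‖)
    (hfLip : ∀ t ≥ (0:ℝ), ∀ ψ₁ ψ₂ : C(Set.Icc (-r) (0:ℝ), X),
      ‖f t ψ₁ - f t ψ₂‖ ≤ Lf * ‖ψ₁ - ψ₂‖)
    (hsmall : Lg + C * M * Lf * |μ| ^ (-(1 / α)) * Real.pi / (α * Real.sin (Real.pi / α)) < 1) :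
    ∃ u : ℝ → X,
      (IsMildSolution r (Set.right_mem_Icc.mpr (by linarith)) S φ g f u ∧ PSAPclass ω r u) ∧
      ∀ v : ℝ → X,
        IsMildSolution r (Set.right_mem_Icc.mpr (by linarith)) S φ g f v ∧ PSAPclass ω r v →
        ∀ t ≥ -r, v t = u t := by
  have hα0 : 0 < α := by linarith
  have hm : 0 < |μ| := abs_pos.2 hμ.ne
  have hCM : 0 < C * M := mul_pos hC hM
  obtain ⟨Bg, hBg⟩ := hg0
  obtain ⟨Bf, hBf⟩ := hf0
  have henorm : ∀ {x : X} {b : ℝ}, ‖x‖ ≤ b → ‖x‖ₑ ≤ (b.toNNReal : ℝ≥0∞) := fun {x b} hx => by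
    rw [← ofReal_norm]; exact ENNReal.ofReal_le_ofReal hx
  have hlipg : ∀ t ≥ 0, LipschitzWith Lg.toNNReal (g t) := fun t ht =>
    LipschitzWith.of_dist_le_mul fun ψ₁ ψ₂ => by
      simpa [dist_eq_norm, Real.coe_toNNReal _ hLg.le] using hgLip t ht ψ₁ ψ₂
  have hlipf : ∀ t ≥ 0, LipschitzWith Lf.toNNReal (f t) := fun t ht =>
    LipschitzWith.of_dist_le_mul fun ψ₁ ψ₂ => by
      simpa [dist_eq_norm, Real.coe_toNNReal _ hLf.le] using hfLip t ht ψ₁ ψ₂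
  have hbg : ∀ t ≥ 0, ‖g t 0‖ₑ ≤ Bg.toNNReal := fun t ht => henorm (hBg t ht)
  have hbf : ∀ t ≥ 0, ‖f t 0‖ₑ ≤ Bf.toNNReal := fun t ht => henorm (hBf t ht)
  have hcg := continuous_uncurry_extend hgcont
  have hcf := continuous_uncurry_extend hfcont
  set κ : ℝ := C * M * (|μ| ^ (-(1 / α)) * Real.pi / (α * Real.sin (Real.pi / α))) with hκ
  have hsin : 0 < Real.sin (Real.pi / α) :=
    Real.sin_pos_of_pos_of_lt_pi (div_pos Real.pi_pos hα0) (div_lt_self Real.pi_pos hα1)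
  have hκ0 : 0 < κ := by have := Real.pi_pos; positivity
  have hH : MildHyp r (fun t => S (max t 0)) (fun t => g (max t 0)) (fun t => f (max t 0))
      (decayKernel α |μ| (C * M)) Lg.toNNReal Lf.toNNReal Bg.toNNReal Bf.toNNReal κ.toNNReal
      (C * M).toNNReal :=
    { continuous_S := fun x => (hScont x).comp_continuous (continuous_id.max continuous_const)
        fun t => le_max_right t 0
      enorm_S_le := fun t => by
        rw [← ofReal_norm]
        exact ENNReal.ofReal_le_ofReal (hSb _ (le_max_right t 0))
      antitone_k := decayKernel_antitone hα0 hm hCM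
      k_le := fun t => by
        refine ENNReal.ofReal_le_ofReal (div_le_self hCM.le ?_)
        have : 0 ≤ |μ| * max t 0 ^ α := by positivity
        linarith
      tendsto_k := decayKernel_tendsto hα0 hm _
      lintegral_k_le := (lintegral_decayKernel hα1 hm hCM).le
      continuous_g := hcg
      continuous_f := hcf
      lipschitz_g := fun t => hlipg _ (le_max_right t 0)
      lipschitz_f := fun t => hlipf _ (le_max_right t 0)
      enorm_g_zero_le := fun t => hbg _ (le_max_right t 0)
      enorm_f_zero_le := fun t => hbf _ (le_max_right t 0) }
  have hlt : Lg.toNNReal + κ.toNNReal * Lf.toNNReal < 1 := by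
    rw [← NNReal.coe_lt_coe, NNReal.coe_add, NNReal.coe_mul, Real.coe_toNNReal _ hLg.le,
      Real.coe_toNNReal _ hLf.le, Real.coe_toNNReal _ hκ0.le, NNReal.coe_one]
    convert hsmall using 2
    rw [hκ]; ring
  obtain ⟨u, hu, mu, huniq⟩ := hH.exists_unique (φ ⟨0, Set.right_mem_Icc.mpr (by linarith)⟩ - g 0 φ)
    hr.le hω.le hlt
    (fun L hL => meanZero_incrementUnif_extend hr.le hω.le hgP hcg hlipg hbg hL)
    (fun L hL => meanZero_incrementUnif_extend hr.le hω.le hfP hcf hlipf hbf hL)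
    (initialProfile hr.le φ) (fun t ht => initialProfile_of_nonneg hr.le φ ht)
  refine ⟨u, ⟨isMildSolution_of_extended_eq hr.le hS0 (hlipg 0 le_rfl)
    (lt_of_le_of_lt le_self_add hlt) hu, pseudoPeriodic_of_meanZero hr.le mu⟩, ?_⟩
  rintro v ⟨hv, -⟩ t ht
  obtain ⟨w, hwv, hw⟩ := hv.exists_extension hr.le
  rw [← hwv t ht, huniq w hw]
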